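/- arXiv:2406.03693 — 3 statements merged into one kernel-verified Lean document; each statement's English description precedes it below -/
import Mathlib

section
/- Let u_i = Π_{1≤j≤n, j≠i}(α_i − α_j)^{−1}, v_i' = u_i v_i^{−1} for 1 ≤ i ≤ n, a = −Σ_{i=1}^n α_i, and b = δ + Σ_{1≤i<j≤n} α_i α_j − (Σ_{i=1}^n α_i)^2. Then the Euclidean dual code C_k(A,v)^⊥ equals { (v_1' g(α_1), …, v_n' g(α_n), −g_{n−k−1} + a·g_{n−k} + b·g_{n−k+1}, −g_{n−k+1}) : g(x) ∈ F_q[x] with deg g ≤ n−k+1 }, where g_j denotes the coefficient of x^j in g(x). -/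
/-- The Euclidean dual of a code `C ⊆ F^N`. -/
def dualCode {F : Type*} [Field F] {N : ℕ} (C : Submodule F (Fin N → F)) :
    Submodule F (Fin N → F) where
  carrier := { y | ∀ x ∈ C, ∑ i, x i * y i = 0 }
  zero_mem' := fun x _ => by simp
  add_mem' := fun {a b} ha hb x hx => by
    have h : ∑ i, x i * (a + b) i = (∑ i, x i * a i) + ∑ i, x i * b i := by
      rw [← Finset.sum_add_distrib]
      exact Finset.sum_congr rfl fun i _ => by simp [mul_add]
    rw [h, ha x hx, hb x hx, add_zero]
  smul_mem' := fun c {a} ha x hx => by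
    have h : ∑ i, x i * (c • a) i = c * ∑ i, x i * a i := by
      rw [Finset.mul_sum]
      exact Finset.sum_congr rfl fun i _ => by
        simp only [Pi.smul_apply, smul_eq_mul]; ring
    rw [h, ha x hx, mul_zero]

/-- The k×(n+2) generator matrix `G_k` of `C_k(A,v)`. -/
noncomputable def Gkmat (F : Type*) [Field F] (n k : ℕ) (α v : Fin n → F) (δ : F) :
    Fin k → Fin (n + 2) → F := fun i j =>
  if hj : (j : ℕ) < n then v ⟨j, hj⟩ * α ⟨j, hj⟩ ^ (if (i : ℕ) = k - 1 then k else (i : ℕ))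
  else if (j : ℕ) = n then (if (i : ℕ) = k - 1 then 1 else 0)
  else if (i : ℕ) = k - 2 then 1 else if (i : ℕ) = k - 1 then δ else 0

open Polynomial in
/-- The functional `f ↦ ∑ u_i f(α_i)`. -/
noncomputable def Sfun {F : Type*} [Field F] {n : ℕ} (α : Fin n → F) (f : F[X]) : F :=
  ∑ i, (∏ l ∈ Finset.univ.erase i, (α i - α l)⁻¹) * f.eval (α i)

open Polynomial in
lemma Sfun_lt {F : Type*} [Field F] {n : ℕ} (α : Fin n → F) (hα : Function.Injective α)
    (f : F[X]) (hf : f.degree < n) : Sfun α f = f.coeff (n - 1) := by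
  have := Lagrange.coeff_eq_sum (s := Finset.univ) (v := α) hα.injOn (P := f) (by simpa using hf)
  rw [Finset.card_univ, Fintype.card_fin] at this
  rw [this, Sfun]
  refine Finset.sum_congr rfl fun i _ => ?_
  rw [Finset.prod_inv_distrib, div_eq_mul_inv, mul_comm]

open Polynomial in
lemma coeff_e1 {F : Type*} [Field F] (n : ℕ) (α : Fin (n + 1) → F) :
    (∏ i, (X - C (α i))).coeff n = -∑ i, α i := by
  simpa using prod_X_sub_C_coeff_card_pred Finset.univ α (by simp)

open Polynomial in
lemma coeff_top {F : Type*} [Field F] (n : ℕ) (α : Fin n → F) :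
    (∏ i, (X - C (α i))).coeff n = 1 := by
  simpa using (monic_prod_X_sub_C α Finset.univ).coeff_natDegree

open Polynomial in
lemma coeff_e2 {F : Type*} [Field F] (n : ℕ) (α : Fin (n + 2) → F) :
    (∏ i, (X - C (α i))).coeff n = ∑ i, ∑ l ∈ Finset.Ioi i, α i * α l := by
  induction n with
  | zero =>
    simp [Fin.sum_univ_succ, Fin.prod_univ_succ, Fin.sum_Ioi_zero, coeff_zero_eq_eval_zero]
  | succ n ih =>
    rw [Fin.prod_univ_succ, sub_mul, coeff_sub, coeff_X_mul, coeff_C_mul, ih, coeff_e1,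
      Fin.sum_univ_succ (n := n + 2)]
    simp only [Fin.sum_Ioi_zero, Fin.sum_Ioi_succ, ← Finset.mul_sum]
    ring

open Polynomial in
lemma Sfun_le {F : Type*} [Field F] {n : ℕ} (α : Fin (n + 2) → F) (hα : Function.Injective α)
    (f : F[X]) (hf : f.natDegree ≤ n + 3) : Sfun α f = f.coeff (n + 1)
      + (∑ i, α i) * f.coeff (n + 2)
      + ((∑ i, α i) ^ 2 - ∑ i, ∑ l ∈ Finset.Ioi i, α i * α l) * f.coeff (n + 3) := by
  set P : F[X] := ∏ i, (X - C (α i)) with hP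
  have h0 := coeff_e2 n α
  have h1 := coeff_e1 (n + 1) α
  have h2 := coeff_top (n + 2) α
  rw [← hP] at h0 h1 h2
  have h3 : ∀ m, n + 2 < m → P.coeff m = 0 := fun m hm =>
    coeff_eq_zero_of_natDegree_lt (by rw [hP, natDegree_finsetProd_X_sub_C_eq_card]; simpa using hm)
  set r : F[X] := f - C (f.coeff (n + 3)) * (X * P)
    - C (f.coeff (n + 2) + f.coeff (n + 3) * ∑ i, α i) * P with hr
  have hS : Sfun α f = Sfun α r := by
    refine Finset.sum_congr rfl fun i _ => ?_
    have : P.eval (α i) = 0 := by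
      rw [hP, eval_prod]
      exact Finset.prod_eq_zero (Finset.mem_univ i) (by simp)
    simp [hr, this]
  have hc : ∀ m, r.coeff (m + 1) = f.coeff (m + 1) - f.coeff (n + 3) * P.coeff m
      - (f.coeff (n + 2) + f.coeff (n + 3) * ∑ i, α i) * P.coeff (m + 1) := by
    intro m
    simp only [hr, coeff_sub, coeff_C_mul, coeff_X_mul]
  have hd : r.degree < ((n + 2 : ℕ) : WithBot ℕ) := by
    rw [degree_lt_iff_coeff_zero]
    intro m hm
    obtain ⟨m, rfl⟩ : ∃ m', m = m' + 1 := ⟨m - 1, by omega⟩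
    rw [hc]
    rcases Nat.lt_or_ge (n + 2) m with h | h
    · rw [h3 m h, h3 (m + 1) (by omega), coeff_eq_zero_of_natDegree_lt (by omega)]; ring
    · obtain rfl | rfl : m = n + 1 ∨ m = n + 2 := by omega
      · rw [h1, h2]; ring
      · rw [h2, h3 _ (by omega)]; ring
  rw [hS, Sfun_lt α hα r hd, show n + 2 - 1 = n + 1 from rfl, hc, h0, h1]
  ring

/-- The tail coordinates. -/
lemma mem_dual_iff {F : Type*} [Field F] (n k : ℕ) (α v : Fin n → F) (δ : F)
    (y : Fin (n + 2) → F) :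
    y ∈ dualCode (Submodule.span F (Set.range (Gkmat F n k α v δ))) ↔
      ∀ i : Fin k, (∑ j : Fin n, v j * α j ^ (if (i : ℕ) = k - 1 then k else (i : ℕ)) *
          y j.castSucc.castSucc)
        + (if (i : ℕ) = k - 1 then 1 else 0) * y (Fin.last n).castSucc
        + (if (i : ℕ) = k - 2 then 1 else if (i : ℕ) = k - 1 then δ else 0) * y (Fin.last (n + 1))
        = 0 := by
  have key : ∀ i : Fin k, ∑ j, Gkmat F n k α v δ i j * y j =
      (∑ j : Fin n, v j * α j ^ (if (i : ℕ) = k - 1 then k else (i : ℕ)) *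
          y j.castSucc.castSucc)
        + (if (i : ℕ) = k - 1 then 1 else 0) * y (Fin.last n).castSucc
        + (if (i : ℕ) = k - 2 then 1 else if (i : ℕ) = k - 1 then δ else 0)
          * y (Fin.last (n + 1)) := by
    intro i
    rw [Fin.sum_univ_castSucc, Fin.sum_univ_castSucc]
    simp [Gkmat]
  simp only [← key]
  constructor
  · intro h i
    exact h _ (Submodule.subset_span ⟨i, rfl⟩)
  · intro h x hx
    induction hx using Submodule.span_induction with
    | mem x hx => obtain ⟨i, rfl⟩ := hx; exact h i
    | zero => simp
    | add x z _ _ hx hz => simp [add_mul, Finset.sum_add_distrib, hx, hz]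
    | smul c x _ hx => simp [mul_assoc, ← Finset.mul_sum, hx]

open Polynomial in
lemma sum_eq_Sfun {F : Type*} [Field F] {n : ℕ} (α v : Fin n → F) (hv : ∀ i, v i ≠ 0)
    (g : F[X]) (y : Fin n → F)
    (hy : ∀ j, y j = (∏ l ∈ Finset.univ.erase j, (α j - α l)⁻¹) * (v j)⁻¹ * g.eval (α j))
    (e : ℕ) : ∑ j, v j * α j ^ e * y j = Sfun α (g * X ^ e) := by
  refine Finset.sum_congr rfl fun j _ => ?_
  have := hv j
  rw [hy, eval_mul, eval_pow, eval_X]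
  field_simp

open Polynomial in
lemma core {F : Type*} [Field F] (n k : ℕ) (hk : 3 ≤ k) (hkn : k ≤ n)
    (α v : Fin n → F) (hα : Function.Injective α) (hv : ∀ i, v i ≠ 0) (δ : F)
    (g : F[X]) (hg : g.natDegree ≤ n - k + 1) (y : Fin (n + 2) → F)
    (hy : ∀ j : Fin n, y j.castSucc.castSucc =
      (∏ l ∈ Finset.univ.erase j, (α j - α l)⁻¹) * (v j)⁻¹ * g.eval (α j)) :
    y ∈ dualCode (Submodule.span F (Set.range (Gkmat F n k α v δ))) ↔
      y (Fin.last n).castSucc = (if k < n then -(g.coeff (n - k - 1)) else 0) +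
                (-(∑ i, α i)) * g.coeff (n - k) +
                (δ + (∑ i, ∑ l ∈ Finset.Ioi i, α i * α l) - (∑ i, α i) ^ 2) *
                  g.coeff (n - k + 1) ∧
      y (Fin.last (n + 1)) = -(g.coeff (n - k + 1)) := by
  rw [mem_dual_iff]
  simp only [sum_eq_Sfun α v hv g (fun j => y j.castSucc.castSucc) hy]
  have hlow : ∀ e, e ≤ k - 2 → Sfun α (g * X ^ e) = (g * X ^ e).coeff (n - 1) := by
    intro e he
    apply Sfun_lt α hα
    apply lt_of_le_of_lt degree_le_natDegree
    have : (g * X ^ e).natDegree ≤ g.natDegree + e := by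
      simpa using natDegree_mul_le (p := g) (q := X ^ e)
    exact_mod_cast (by omega : (g * X ^ e).natDegree < n)
  have hlow0 : ∀ e, e < k - 2 → Sfun α (g * X ^ e) = 0 := by
    intro e he
    rw [hlow e he.le, coeff_mul_X_pow', if_pos (by omega)]
    exact coeff_eq_zero_of_natDegree_lt (by omega)
  have hmid : Sfun α (g * X ^ (k - 2)) = g.coeff (n - k + 1) := by
    rw [hlow _ le_rfl, coeff_mul_X_pow', if_pos (by omega)]
    congr 1; omega
  have htop : Sfun α (g * X ^ k) = (if k < n then g.coeff (n - k - 1) else 0)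
      + (∑ i, α i) * g.coeff (n - k)
      + ((∑ i, α i) ^ 2 - ∑ i, ∑ l ∈ Finset.Ioi i, α i * α l) * g.coeff (n - k + 1) := by
    obtain ⟨m, rfl⟩ : ∃ m, n = m + 2 := ⟨n - 2, by omega⟩
    have : (g * X ^ k).natDegree ≤ g.natDegree + k := by
      simpa using natDegree_mul_le (p := g) (q := X ^ k)
    rw [Sfun_le α hα _ (by omega)]
    simp only [coeff_mul_X_pow']
    rw [if_pos (show k ≤ m + 2 by omega), if_pos (show k ≤ m + 3 by omega),
      show m + 3 - k = m + 2 - k + 1 by omega, show m + 2 - k - 1 = m + 1 - k by omega]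
    congr 3
    exact propext (by omega)
  constructor
  · intro h
    have a1 := h ⟨k - 2, by omega⟩
    have a2 := h ⟨k - 1, by omega⟩
    have ne : k - 2 ≠ k - 1 := by omega
    simp only [ne, ne.symm, if_true, if_false, hmid, htop] at a1 a2
    have b1 : y (Fin.last (n + 1)) = -(g.coeff (n - k + 1)) := by linear_combination a1
    refine ⟨?_, b1⟩
    rw [b1] at a2
    split_ifs at a2 ⊢ <;> linear_combination a2
  · rintro ⟨h1, h2⟩ ⟨i, hi⟩
    have ne : k - 2 ≠ k - 1 := by omega
    rcases lt_trichotomy i (k - 2) with h | h | h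
    · simp [hlow0 i h, h.ne, (show i ≠ k - 1 by omega)]
    · subst h
      simp only [ne, if_true, if_false, hmid, h2]; ring
    · obtain rfl : i = k - 1 := by omega
      simp only [ne.symm, if_true, if_false, htop, h1, h2]
      split_ifs <;> ring

open Polynomial in
lemma exists_poly {F : Type*} [Field F] (n k : ℕ) (hk : 3 ≤ k) (hkn : k ≤ n)
    (α v : Fin n → F) (hα : Function.Injective α) (hv : ∀ i, v i ≠ 0) (δ : F)
    (y : Fin (n + 2) → F)
    (hy : y ∈ dualCode (Submodule.span F (Set.range (Gkmat F n k α v δ)))) :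
    ∃ g : F[X], g.natDegree ≤ n - k + 1 ∧ ∀ j : Fin n, y j.castSucc.castSucc =
      (∏ l ∈ Finset.univ.erase j, (α j - α l)⁻¹) * (v j)⁻¹ * g.eval (α j) := by
  set r : Fin n → F := fun j => (∏ l ∈ Finset.univ.erase j, (α j - α l)) * v j *
    y j.castSucc.castSucc with hr
  set g := Lagrange.interpolate Finset.univ α r with hgdef
  have hge : ∀ j, g.eval (α j) = r j := fun j =>
    Lagrange.eval_interpolate_at_node r hα.injOn (Finset.mem_univ j)
  have hgd : g.degree < n := by
    have h := Lagrange.degree_interpolate_lt (s := Finset.univ) r hα.injOn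
    rwa [Finset.card_univ, Fintype.card_fin] at h
  have hgy : ∀ j : Fin n, y j.castSucc.castSucc =
      (∏ l ∈ Finset.univ.erase j, (α j - α l)⁻¹) * (v j)⁻¹ * g.eval (α j) := by
    intro j
    have h1 := hv j
    have h2 : ∏ l ∈ Finset.univ.erase j, (α j - α l) ≠ 0 :=
      Finset.prod_ne_zero_iff.2 fun l hl =>
        sub_ne_zero.2 fun h => (Finset.ne_of_mem_erase hl) (hα h).symm
    rw [hge, hr, Finset.prod_inv_distrib]
    field_simp
  refine ⟨g, ?_, hgy⟩
  by_contra! hlt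
  have hg0 : g ≠ 0 := by rintro h; rw [h] at hlt; simp at hlt
  have hdn : g.natDegree < n := (natDegree_lt_iff_degree_lt hg0).2 hgd
  rw [mem_dual_iff] at hy
  have h := hy ⟨n - 1 - g.natDegree, by omega⟩
  simp only [sum_eq_Sfun α v hv g (fun j => y j.castSucc.castSucc) hgy] at h
  rw [if_neg (by omega), if_neg (by omega), if_neg (by omega), if_neg (by omega),
    Sfun_lt α hα, coeff_mul_X_pow', if_pos (by omega),
    show n - 1 - (n - 1 - g.natDegree) = g.natDegree by omega] at h
  · simp [hg0] at h
  · rw [degree_mul, degree_X_pow, degree_eq_natDegree hg0]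
    exact_mod_cast (by omega : g.natDegree + (n - 1 - g.natDegree) < n)

/-- The dual code `C_k(A,v)^⊥` consists exactly of the words
`(v'_1 g(α_1), …, v'_n g(α_n), -g_{n-k-1} + a·g_{n-k} + b·g_{n-k+1}, -g_{n-k+1})`
for polynomials `g` of degree at most `n-k+1`, where `v'_i = u_i v_i⁻¹`,
`u_i = ∏_{j≠i}(α_i - α_j)⁻¹`, `a = -∑ α_i` and `b = δ + ∑_{i<j} α_i α_j - (∑ α_i)²`.
(The coefficient `g_{n-k-1}` of `x^{n-k-1}` is read as `0` when `n - k - 1 < 0`,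
i.e. when `k = n`.) -/
theorem stmt_3 (F : Type*) [Field F] [Fintype F] (n k : ℕ)
    (hk : 3 ≤ k) (hkn : k ≤ n) (hnq : n ≤ Fintype.card F)
    (α v : Fin n → F) (hα : Function.Injective α) (hv : ∀ i, v i ≠ 0) (δ : F) :
    (dualCode (Submodule.span F (Set.range (Gkmat F n k α v δ))) : Set (Fin (n + 2) → F)) =
      { y : Fin (n + 2) → F | ∃ g : Polynomial F, g.natDegree ≤ n - k + 1 ∧
          y = fun j : Fin (n + 2) =>
            if hj : (j : ℕ) < n then
              (∏ l ∈ Finset.univ.erase ⟨j, hj⟩, (α ⟨j, hj⟩ - α l)⁻¹) * (v ⟨j, hj⟩)⁻¹ *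
                Polynomial.eval (α ⟨j, hj⟩) g
            else if (j : ℕ) = n then
              (if k < n then -(g.coeff (n - k - 1)) else 0) +
                (-(∑ i, α i)) * g.coeff (n - k) +
                (δ + (∑ i, ∑ l ∈ Finset.Ioi i, α i * α l) - (∑ i, α i) ^ 2) *
                  g.coeff (n - k + 1)
            else -(g.coeff (n - k + 1)) } := by
  ext y
  simp only [SetLike.mem_coe, Set.mem_setOf_eq]
  constructor
  · intro hy
    obtain ⟨g, hg, hgy⟩ := exists_poly n k hk hkn α v hα hv δ y hy
    obtain ⟨h1, h2⟩ := (core n k hk hkn α v hα hv δ g hg y hgy).1 hy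
    refine ⟨g, hg, ?_⟩
    funext j
    refine Fin.lastCases ?_ (fun j => Fin.lastCases ?_ (fun j => ?_) j) j
    · rw [h2]; simp
    · rw [h1]; simp
    · rw [hgy]; simp
  · rintro ⟨g, hg, rfl⟩
    refine (core n k hk hkn α v hα hv δ g hg _ fun j => ?_).2 ⟨?_, ?_⟩ <;> simp
end

section
/- The code C_k(A,v) is AMDS (i.e., since it has length n+2 and dimension k, its minimum Hamming distance equals n−k+2) if and only if the following three conditions hold: (a) for every subset I ⊆ {1,…,n} of size k+1 there exists a subset J ⊆ I of size k with Σ_{i∈J} α_i ≠ 0; (b) for every subset I' ⊆ {1,…,n} of size k there exists a subset J' ⊆ I' of size k−1 with δ − (Σ_{i∈J'} α_i)^2 + Σ_{i<j, i,j∈J'} α_i α_j ≠ 0; and (c) either there exists a subset L ⊆ {1,…,n} of size k with Σ_{i∈L} α_i = 0, or there exists a subset M ⊆ {1,…,n} of size k−1 with δ = (Σ_{i∈M} α_i)^2 − Σ_{i<j, i,j∈M} α_i α_j. -/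
/-- `minDist C d` : the minimum Hamming distance of the linear code `C` equals `d`. -/
def minDist {F : Type*} [Field F] [DecidableEq F] {N : ℕ}
    (C : Submodule F (Fin N → F)) (d : ℕ) : Prop :=
  (∃ c ∈ C, c ≠ 0 ∧ hammingNorm c = d) ∧ ∀ c ∈ C, c ≠ 0 → d ≤ hammingNorm c

open Polynomial

namespace AMDS

variable {F : Type*} [Field F] {n : ℕ}

/-- second elementary symmetric sum -/
def e2 (α : Fin n → F) (S : Finset (Fin n)) : F :=
  ∑ i ∈ S, ∑ j ∈ S.filter (fun j => i < j), α i * α j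

/-- vanishing polynomial -/
noncomputable def P (α : Fin n → F) (S : Finset (Fin n)) : F[X] :=
  ∏ i ∈ S, (X - C (α i))

/-- the basic polynomial with zero second coefficient -/
noncomputable def g (α : Fin n → F) (S : Finset (Fin n)) : F[X] :=
  P α S * (X + C (∑ i ∈ S, α i))

lemma e2_insert (α : Fin n → F) (S : Finset (Fin n)) (a : Fin n) (ha : a ∉ S) :
    e2 α (insert a S) = e2 α S + α a * ∑ i ∈ S, α i := by
  unfold e2
  simp only [Finset.sum_filter]
  rw [Finset.sum_insert ha, Finset.sum_insert ha]
  have h1 : ∀ i ∈ S, (∑ j ∈ insert a S, if i < j then α i * α j else 0)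
      = (if i < a then α i * α a else 0) + ∑ j ∈ S, if i < j then α i * α j else 0 := by
    intro i _
    rw [Finset.sum_insert ha]
  rw [Finset.sum_congr rfl h1, Finset.sum_add_distrib, Finset.mul_sum]
  have h2 : ∑ i ∈ S, α a * α i = (∑ i ∈ S, if a < i then α a * α i else 0)
      + ∑ i ∈ S, if i < a then α i * α a else 0 := by
    rw [← Finset.sum_add_distrib]
    apply Finset.sum_congr rfl
    intro i hi
    have : i ≠ a := fun h => ha (h ▸ hi)
    rcases lt_or_gt_of_ne this with h | h
    · simp [h, h.not_gt, mul_comm]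
    · simp [h, h.not_gt]
  rw [h2]
  simp
  ring

lemma P_monic (α : Fin n → F) (S : Finset (Fin n)) : (P α S).Monic :=
  monic_prod_of_monic _ _ fun i _ => monic_X_sub_C _

lemma P_natDegree (α : Fin n → F) (S : Finset (Fin n)) : (P α S).natDegree = S.card := by
  unfold P
  rw [natDegree_prod_of_monic _ _ fun i _ => monic_X_sub_C _]
  simp

lemma P_coeff (α : Fin n → F) (S : Finset (Fin n)) :
    (X ^ 2 * P α S).coeff (S.card + 2) = 1 ∧
    (X ^ 2 * P α S).coeff (S.card + 1) = - ∑ i ∈ S, α i ∧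
    (X ^ 2 * P α S).coeff (S.card) = e2 α S := by
  induction S using Finset.induction_on with
  | empty => simp [P, e2, coeff_X_pow]
  | insert a S ha ih =>
    obtain ⟨h1, h2, h3⟩ := ih
    have h0 : (X ^ 2 * P α S).coeff (S.card + 3) = 0 := by
      rw [show S.card + 3 = (S.card + 1) + 2 by ring, coeff_X_pow_mul]
      apply coeff_eq_zero_of_natDegree_lt
      rw [P_natDegree]; omega
    have hP : X ^ 2 * P α (insert a S) = X * (X ^ 2 * P α S) - C (α a) * (X ^ 2 * P α S) := by
      unfold P
      rw [Finset.prod_insert ha]; ring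
    rw [hP, Finset.card_insert_of_notMem ha, e2_insert α S a ha, Finset.sum_insert ha]
    simp only [coeff_sub, coeff_C_mul]
    rw [show S.card + 1 + 2 = S.card + 2 + 1 by ring, coeff_X_mul, coeff_X_mul, coeff_X_mul,
      h1, show S.card + 2 + 1 = S.card + 3 by ring, h0]
    rw [h2, h3]
    refine ⟨by ring, by ring, by ring⟩

lemma g_coeff (α : Fin n → F) (M : Finset (Fin n)) (m : ℕ) (hM : M.card = m + 2) :
    (g α M).coeff (m + 3) = 1 ∧ (g α M).coeff (m + 2) = 0 ∧
    (g α M).coeff (m + 1) = e2 α M - (∑ i ∈ M, α i) ^ 2 := by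
  obtain ⟨h1, h2, h3⟩ := P_coeff α M
  rw [hM] at h1 h2 h3
  have h0 : (P α M).coeff (m + 3) = 0 := by
    apply coeff_eq_zero_of_natDegree_lt
    rw [P_natDegree]; omega
  rw [coeff_X_pow_mul] at h1
  rw [show m + 2 + 1 = (m + 1) + 2 by ring, coeff_X_pow_mul] at h2
  rw [coeff_X_pow_mul] at h3
  unfold g
  simp only [mul_add, coeff_add, coeff_mul_C, coeff_mul_X]
  rw [h0, h1, h2, h3]
  refine ⟨by ring, by ring, by ring⟩

lemma g_natDegree (α : Fin n → F) (M : Finset (Fin n)) (m : ℕ) (hM : M.card = m + 2) :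
    (g α M).natDegree ≤ m + 3 := by
  unfold g
  refine natDegree_mul_le.trans ?_
  rw [P_natDegree, hM, natDegree_X_add_C]

lemma g_eval (α : Fin n → F) (M : Finset (Fin n)) (x : F) :
    (g α M).eval x = (∏ i ∈ M, (x - α i)) * (x + ∑ i ∈ M, α i) := by
  unfold g P
  rw [eval_mul, eval_prod, eval_add, eval_X, eval_C]
  simp only [eval_sub, eval_X, eval_C]

lemma zero_of_roots (α : Fin n → F) (hα : Function.Injective α) (f : F[X]) (S : Finset (Fin n))
    (h : ∀ i ∈ S, f.eval (α i) = 0) (hd : f.natDegree < S.card) : f = 0 := by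
  classical
  apply eq_zero_of_natDegree_lt_card_of_eval_eq_zero' f (S.image α)
  · intro x hx
    obtain ⟨i, hi, rfl⟩ := Finset.mem_image.1 hx
    exact h i hi
  · rwa [Finset.card_image_of_injective _ hα]

lemma f_eq (α : Fin n → F) (hα : Function.Injective α) (f : F[X]) (M : Finset (Fin n)) (m : ℕ)
    (hM : M.card = m + 2) (hd : f.natDegree ≤ m + 3) (hc : f.coeff (m + 2) = 0)
    (h : ∀ i ∈ M, f.eval (α i) = 0) : f = C (f.coeff (m + 3)) * g α M := by
  rw [← sub_eq_zero]
  obtain ⟨h1, h2, h3⟩ := g_coeff α M m hM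
  apply zero_of_roots α hα _ M
  · intro i hi
    rw [eval_sub, eval_mul, h i hi, g_eval, Finset.prod_eq_zero hi (sub_self _)]
    simp
  · rw [hM]
    have hle : (f - C (f.coeff (m + 3)) * g α M).natDegree ≤ m + 1 := by
      rw [natDegree_le_iff_coeff_eq_zero]
      intro N hN
      rw [coeff_sub, coeff_C_mul]
      rcases eq_or_ne N (m + 2) with rfl | hN2
      · rw [hc, h2]; ring
      rcases eq_or_ne N (m + 3) with rfl | hN3
      · rw [h1]; ring
      · rw [coeff_eq_zero_of_natDegree_lt (show f.natDegree < N by omega),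
          coeff_eq_zero_of_natDegree_lt
            (lt_of_le_of_lt (g_natDegree α M m hM) (show m + 3 < N by omega))]
        ring
    omega

/-- the encoder -/
noncomputable def enc (m : ℕ) (α v : Fin n → F) (δ : F) : F[X] →ₗ[F] (Fin (n + 2) → F) where
  toFun f := fun j => if hj : (j : ℕ) < n then v ⟨j, hj⟩ * f.eval (α ⟨j, hj⟩)
    else if (j : ℕ) = n then f.coeff (m + 3) else f.coeff (m + 1) + δ * f.coeff (m + 3)
  map_add' f g := by
    ext j
    simp only [Pi.add_apply]
    split_ifs <;> simp <;> ring
  map_smul' c f := by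
    ext j
    simp only [Pi.smul_apply, RingHom.id_apply]
    split_ifs <;> simp <;> ring

lemma enc_gen (m : ℕ) (α v : Fin n → F) (δ : F) (i : Fin (m + 3)) :
    enc m α v δ (X ^ (if (i : ℕ) = m + 2 then m + 3 else (i : ℕ))) =
      Gkmat F n (m + 3) α v δ i := by
  ext j
  have hi := i.2
  simp only [enc, Gkmat, LinearMap.coe_mk, AddHom.coe_mk, show m + 3 - 1 = m + 2 by omega,
    show m + 3 - 2 = m + 1 by omega, eval_pow, eval_X, coeff_X_pow]
  by_cases h1 : (j : ℕ) < n
  · simp [h1]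
  · simp only [h1, dite_false]
    by_cases h2 : (i : ℕ) = m + 2
    · simp [h2]
    · have h3 : m + 3 ≠ (i : ℕ) := by omega
      simp [h2, h3, eq_comm]

lemma mem_code (m : ℕ) (α v : Fin n → F) (δ : F) (c : Fin (n + 2) → F) :
    c ∈ Submodule.span F (Set.range (Gkmat F n (m + 3) α v δ)) ↔
      ∃ f : F[X], f.natDegree ≤ m + 3 ∧ f.coeff (m + 2) = 0 ∧ enc m α v δ f = c := by
  constructor
  · intro h
    induction h using Submodule.span_induction with
    | mem x hx =>
      obtain ⟨i, rfl⟩ := hx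
      have hi := i.2
      refine ⟨_, ?_, ?_, enc_gen m α v δ i⟩
      · rw [natDegree_X_pow]; split_ifs <;> omega
      · rw [coeff_X_pow, if_neg]; split_ifs <;> omega
    | zero => exact ⟨0, by simp, by simp, by simp⟩
    | add x y _ _ hx hy =>
      obtain ⟨f, h1, h2, h3⟩ := hx
      obtain ⟨f', h1', h2', h3'⟩ := hy
      exact ⟨f + f', (natDegree_add_le _ _).trans (max_le h1 h1'), by simp [h2, h2'],
        by simp [h3, h3']⟩
    | smul a x _ hx =>
      obtain ⟨f, h1, h2, h3⟩ := hx
      exact ⟨a • f, (natDegree_smul_le _ _).trans h1, by simp [h2], by simp [h3]⟩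
  · rintro ⟨f, h1, h2, rfl⟩
    rw [f.as_sum_range_C_mul_X_pow' (n := m + 4) (by omega), map_sum]
    apply Submodule.sum_mem
    intro i hi
    rw [← smul_eq_C_mul, map_smul]
    have hi' := Finset.mem_range.1 hi
    rcases eq_or_ne i (m + 2) with rfl | hi2
    · rw [h2]; simp
    apply Submodule.smul_mem
    apply Submodule.subset_span
    rcases eq_or_ne i (m + 3) with rfl | hi3
    · refine ⟨⟨m + 2, by omega⟩, ?_⟩
      rw [← enc_gen]; simp
    · refine ⟨⟨i, by omega⟩, ?_⟩
      rw [← enc_gen]; simp [hi2]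

variable [DecidableEq F]

/-- zero positions among evaluation points -/
def Z (α : Fin n → F) (f : F[X]) : Finset (Fin n) := {i | f.eval (α i) = 0}

/-- number of zeros of the codeword -/
noncomputable def W (m : ℕ) (α : Fin n → F) (δ : F) (f : F[X]) : ℕ :=
  (Z α f).card + (if f.coeff (m + 3) = 0 then 1 else 0) +
    (if f.coeff (m + 1) + δ * f.coeff (m + 3) = 0 then 1 else 0)

lemma norm_add_W (m : ℕ) (α v : Fin n → F) (hv : ∀ i, v i ≠ 0) (δ : F) (f : F[X]) :
    hammingNorm (enc m α v δ f) + W m α δ f = n + 2 := by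
  unfold hammingNorm W Z
  rw [Finset.card_filter, Finset.card_filter, Fin.sum_univ_castSucc, Fin.sum_univ_castSucc]
  have h : ∑ i : Fin n, (if enc m α v δ f i.castSucc.castSucc ≠ 0 then 1 else 0)
      + ∑ i : Fin n, (if f.eval (α i) = 0 then 1 else 0) = n := by
    rw [← Finset.sum_add_distrib]
    rw [Finset.sum_congr rfl (g := fun _ => 1)]
    · simp
    · intro i _
      by_cases h : f.eval (α i) = 0 <;> simp [enc, h, hv]
  have h2 : enc m α v δ f (Fin.last n).castSucc = f.coeff (m + 3) := by simp [enc]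
  have h3 : enc m α v δ f (Fin.last (n + 1)) = f.coeff (m + 1) + δ * f.coeff (m + 3) := by
    simp [enc]
  rw [h2, h3]
  split_ifs <;> first | omega | (simp_all <;> omega)

lemma W_small (m : ℕ) (α : Fin n → F) (hα : Function.Injective α) (δ : F) (f : F[X])
    (hf : f ≠ 0) (hd : f.natDegree ≤ m + 3) (hc : f.coeff (m + 2) = 0)
    (h0 : f.coeff (m + 3) = 0) : W m α δ f ≤ m + 2 := by
  have hz : (Z α f).card ≤ f.natDegree := by
    by_contra h
    exact hf (zero_of_roots α hα f (Z α f) (fun i hi => by simpa [Z] using hi) (by omega))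
  have hne : f.coeff f.natDegree ≠ 0 := by
    simpa using hf
  have h2 : f.natDegree ≠ m + 2 := fun h => hne (h ▸ hc)
  have h3 : f.natDegree ≠ m + 3 := fun h => hne (h ▸ h0)
  unfold W
  rw [if_pos h0, h0, mul_zero, add_zero]
  split_ifs with h1
  · have h4 : f.natDegree ≠ m + 1 := fun h => hne (h ▸ h1)
    omega
  · omega

/-- if f vanishes on a (m+3)-set, then its sum vanishes -/
lemma sum_zero (m : ℕ) (α : Fin n → F) (hα : Function.Injective α) (f : F[X])
    (hd : f.natDegree ≤ m + 3) (hc : f.coeff (m + 2) = 0)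
    (h0 : f.coeff (m + 3) ≠ 0) (L : Finset (Fin n)) (hL : L.card = m + 3)
    (h : ∀ i ∈ L, f.eval (α i) = 0) : ∑ i ∈ L, α i = 0 := by
  obtain ⟨a, ha⟩ : L.Nonempty := Finset.card_pos.1 (by omega)
  have hf := f_eq α hα f (L.erase a) m (by rw [Finset.card_erase_of_mem ha]; omega) hd hc
    (fun i hi => h i (Finset.mem_of_mem_erase hi))
  have hE := h a ha
  rw [hf, eval_mul, eval_C, g_eval, Finset.add_sum_erase _ _ ha] at hE
  have hp : ∏ i ∈ L.erase a, (α a - α i) ≠ 0 := by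
    rw [Finset.prod_ne_zero_iff]
    intro i hi h
    exact (Finset.ne_of_mem_erase hi) (hα (sub_eq_zero.1 h)).symm
  simpa [h0, hp] using hE

lemma delta_eq (m : ℕ) (α : Fin n → F) (hα : Function.Injective α) (δ : F) (f : F[X])
    (hd : f.natDegree ≤ m + 3) (hc : f.coeff (m + 2) = 0)
    (h0 : f.coeff (m + 3) ≠ 0) (h1 : f.coeff (m + 1) + δ * f.coeff (m + 3) = 0)
    (M : Finset (Fin n)) (hM : M.card = m + 2)
    (h : ∀ i ∈ M, f.eval (α i) = 0) : δ = (∑ i ∈ M, α i) ^ 2 - e2 α M := by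
  have hf := f_eq α hα f M m hM hd hc h
  obtain ⟨g1, g2, g3⟩ := g_coeff α M m hM
  have h4 : f.coeff (m + 1) = f.coeff (m + 3) * (e2 α M - (∑ i ∈ M, α i) ^ 2) := by
    conv_lhs => rw [hf]
    rw [coeff_C_mul, g3]
  rw [h4] at h1
  have : f.coeff (m + 3) * (δ - ((∑ i ∈ M, α i) ^ 2 - e2 α M)) = 0 := by
    linear_combination h1
  rcases mul_eq_zero.1 this with h | h
  · exact absurd h h0
  · exact sub_eq_zero.1 h

lemma g_zeros (α : Fin n → F) (M : Finset (Fin n)) : M ⊆ Z α (g α M) := by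
  intro i hi
  simp only [Z, Finset.mem_filter, Finset.mem_univ, true_and]
  rw [g_eval, Finset.prod_eq_zero hi (sub_self _), zero_mul]

lemma g_zeros' (α : Fin n → F) (L : Finset (Fin n)) (a : Fin n) (ha : a ∈ L)
    (h : ∑ i ∈ L, α i = 0) : L ⊆ Z α (g α (L.erase a)) := by
  intro i hi
  by_cases hia : i = a
  · subst hia
    simp only [Z, Finset.mem_filter, Finset.mem_univ, true_and]
    rw [g_eval, Finset.add_sum_erase _ _ ha, h, mul_zero]
  · exact g_zeros α _ (Finset.mem_erase.2 ⟨hia, hi⟩)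

lemma g_last (m : ℕ) (α : Fin n → F) (δ : F) (M : Finset (Fin n)) (hM : M.card = m + 2)
    (h : δ = (∑ i ∈ M, α i) ^ 2 - e2 α M) :
    (g α M).coeff (m + 1) + δ * (g α M).coeff (m + 3) = 0 := by
  obtain ⟨g1, g2, g3⟩ := g_coeff α M m hM
  rw [g1, g3, h]; ring

lemma enc_ne_zero (m : ℕ) (α v : Fin n → F) (δ : F) (f : F[X]) (h : f.coeff (m + 3) ≠ 0) :
    enc m α v δ f ≠ 0 := by
  intro h0
  have := congrFun h0 (Fin.last n).castSucc
  simp [enc] at this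
  exact h this

lemma all_delta (m : ℕ) (α : Fin n → F) (hα : Function.Injective α) (δ : F)
    (L : Finset (Fin n)) (hL : L.card = m + 3)
    (h : ∀ J ⊆ L, J.card = m + 2 → δ = (∑ i ∈ J, α i) ^ 2 - e2 α J) :
    ∑ i ∈ L, α i = 0 := by
  have key : ∀ a ∈ L, δ = (∑ i ∈ L, α i) ^ 2 - α a * (∑ i ∈ L, α i) - e2 α L := by
    intro a ha
    have h1 := h (L.erase a) (Finset.erase_subset _ _)
      (by rw [Finset.card_erase_of_mem ha]; omega)
    have h2 := e2_insert α (L.erase a) a (Finset.notMem_erase _ _)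
    rw [Finset.insert_erase ha] at h2
    have h3 := Finset.add_sum_erase L α ha
    rw [h1, h2, ← h3]; ring
  obtain ⟨a, ha, b, hb, hab⟩ := Finset.one_lt_card.1 (show 1 < L.card by omega)
  have : (α a - α b) * ∑ i ∈ L, α i = 0 := by
    linear_combination key a ha - key b hb
  rcases mul_eq_zero.1 this with h | h
  · exact absurd (hα (sub_eq_zero.1 h)) hab
  · exact h

lemma cond_a (k : ℕ) (hk : 1 ≤ k) (α : Fin n → F) (hα : Function.Injective α)
    (I : Finset (Fin n)) (hI : I.card = k + 1) :
    ∃ J ⊆ I, J.card = k ∧ ∑ i ∈ J, α i ≠ 0 := by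
  by_contra! h
  obtain ⟨a, ha, b, hb, hab⟩ := Finset.one_lt_card.1 (show 1 < I.card by omega)
  have key : ∀ x ∈ I, ∑ i ∈ I, α i = α x := by
    intro x hx
    rw [← Finset.add_sum_erase I α hx, h _ (Finset.erase_subset _ _)
      (by rw [Finset.card_erase_of_mem hx]; omega), add_zero]
  exact hab (hα ((key a ha).symm.trans (key b hb)))

end AMDS

open AMDS

/-- `C_k(A,v)` (of length `n+2` and dimension `k`) is AMDS, i.e. its minimum Hamming
distance equals `n-k+2`, iff conditions (a), (b) and (c) hold. -/
theorem stmt_9 (F : Type*) [Field F] [Fintype F] [DecidableEq F] (n k : ℕ)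
    (hk : 3 ≤ k) (hkn : k ≤ n) (hnq : n ≤ Fintype.card F)
    (α v : Fin n → F) (hα : Function.Injective α) (hv : ∀ i, v i ≠ 0) (δ : F) :
    minDist (Submodule.span F (Set.range (Gkmat F n k α v δ))) (n - k + 2) ↔
      ((∀ I : Finset (Fin n), I.card = k + 1 →
          ∃ J ⊆ I, J.card = k ∧ ∑ i ∈ J, α i ≠ 0) ∧
        (∀ I' : Finset (Fin n), I'.card = k →
          ∃ J' ⊆ I', J'.card = k - 1 ∧
            δ - (∑ i ∈ J', α i) ^ 2 +
              (∑ i ∈ J', ∑ j ∈ J'.filter (fun j => i < j), α i * α j) ≠ 0) ∧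
        ((∃ L : Finset (Fin n), L.card = k ∧ ∑ i ∈ L, α i = 0) ∨
          (∃ M : Finset (Fin n), M.card = k - 1 ∧
            δ = (∑ i ∈ M, α i) ^ 2 -
              ∑ i ∈ M, ∑ j ∈ M.filter (fun j => i < j), α i * α j))) := by
  clear hnq
  obtain ⟨m, rfl⟩ : ∃ m, k = m + 3 := ⟨k - 3, by omega⟩
  simp only [show m + 3 - 1 = m + 2 by omega]
  change _ ↔ (_ ∧ (∀ I' : Finset (Fin n), I'.card = m + 3 → ∃ J' ⊆ I', J'.card = m + 2 ∧
      δ - (∑ i ∈ J', α i) ^ 2 + e2 α J' ≠ 0) ∧ (_ ∨ (∃ M : Finset (Fin n), M.card = m + 2 ∧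
        δ = (∑ i ∈ M, α i) ^ 2 - e2 α M)))
  constructor
  · rintro ⟨⟨c, hc, hc0, hcd⟩, hmin⟩
    refine ⟨fun I hI => cond_a _ (by omega) α hα I hI, ?_, ?_⟩
    · intro L hL
      by_contra! h
      have h' : ∀ J ⊆ L, J.card = m + 2 → δ = (∑ i ∈ J, α i) ^ 2 - e2 α J := by
        intro J hJ hJc
        linear_combination h J hJ hJc
      have hs := all_delta m α hα δ L hL h'
      obtain ⟨a, ha⟩ : L.Nonempty := Finset.card_pos.1 (by omega)
      have hM : (L.erase a).card = m + 2 := by rw [Finset.card_erase_of_mem ha]; omega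
      obtain ⟨g1, g2, g3⟩ := g_coeff α _ m hM
      have hw := hmin _ ((mem_code m α v δ _).2 ⟨g α (L.erase a), g_natDegree α _ m hM, g2, rfl⟩)
        (enc_ne_zero m α v δ _ (by rw [g1]; exact one_ne_zero))
      have hn := norm_add_W m α v hv δ (g α (L.erase a))
      have hz := Finset.card_le_card (g_zeros' α L a ha hs)
      have hl := g_last m α δ _ hM (h' _ (Finset.erase_subset _ _) hM)
      unfold W at hn
      rw [if_pos hl] at hn
      omega
    · obtain ⟨f, hd, hf2, rfl⟩ := (mem_code m α v δ _).1 hc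
      have hf0 : f ≠ 0 := by rintro rfl; simp at hc0
      have hn := norm_add_W m α v hv δ f
      have h3 : f.coeff (m + 3) ≠ 0 := by
        intro h3
        have := W_small m α hα δ f hf0 hd hf2 h3
        omega
      unfold W at hn
      rw [if_neg h3] at hn
      by_cases hl : f.coeff (m + 1) + δ * f.coeff (m + 3) = 0
      · right
        rw [if_pos hl] at hn
        obtain ⟨M, hMs, hM⟩ := Finset.exists_subset_card_eq (s := Z α f) (n := m + 2) (by omega)
        exact ⟨M, hM, delta_eq m α hα δ f hd hf2 h3 hl M hM
          (fun i hi => by simpa [Z] using hMs hi)⟩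
      · left
        rw [if_neg hl] at hn
        obtain ⟨L, hLs, hL⟩ := Finset.exists_subset_card_eq (s := Z α f) (n := m + 3) (by omega)
        exact ⟨L, hL, sum_zero m α hα f hd hf2 h3 L hL (fun i hi => by simpa [Z] using hLs hi)⟩
  · rintro ⟨-, hb, hc⟩
    have hW : ∀ f : F[X], f ≠ 0 → f.natDegree ≤ m + 3 → f.coeff (m + 2) = 0 →
        W m α δ f ≤ m + 3 := by
      intro f hf hd h2
      by_cases h3 : f.coeff (m + 3) = 0
      · exact (W_small m α hα δ f hf hd h2 h3).trans (by omega)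
      by_contra hlt
      have hz : (Z α f).card ≤ m + 3 := by
        by_contra h
        exact hf (zero_of_roots α hα f (Z α f) (fun i hi => by simpa [Z] using hi) (by omega))
      unfold W at hlt
      rw [if_neg h3] at hlt
      by_cases hl : f.coeff (m + 1) + δ * f.coeff (m + 3) = 0
      · rw [if_pos hl] at hlt
        obtain ⟨J, hJ, hJc, hJd⟩ := hb (Z α f) (by omega)
        apply hJd
        have := delta_eq m α hα δ f hd h2 h3 hl J hJc (fun i hi => by simpa [Z] using hJ hi)
        linear_combination this
      · rw [if_neg hl] at hlt
        omega
    have hex : ∃ M : Finset (Fin n), M.card = m + 2 ∧ m + 3 ≤ W m α δ (g α M) := by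
      rcases hc with ⟨L, hL, hs⟩ | ⟨M, hM, hδ⟩
      · obtain ⟨a, ha⟩ : L.Nonempty := Finset.card_pos.1 (by omega)
        refine ⟨L.erase a, by rw [Finset.card_erase_of_mem ha]; omega, ?_⟩
        have hz := Finset.card_le_card (g_zeros' α L a ha hs)
        unfold W
        omega
      · refine ⟨M, hM, ?_⟩
        have hz := Finset.card_le_card (g_zeros α M)
        unfold W
        rw [if_pos (g_last m α δ M hM hδ)]
        omega
    constructor
    · obtain ⟨M, hM, hMW⟩ := hex
      obtain ⟨g1, g2, g3⟩ := g_coeff α _ m hM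
      have hne : (g α M).coeff (m + 3) ≠ 0 := by rw [g1]; exact one_ne_zero
      refine ⟨_, (mem_code m α v δ _).2 ⟨g α M, g_natDegree α _ m hM, g2, rfl⟩,
        enc_ne_zero m α v δ _ hne, ?_⟩
      have hn := norm_add_W m α v hv δ (g α M)
      have := hW (g α M) (by intro h; rw [h] at hne; simp at hne) (g_natDegree α _ m hM) g2
      omega
    · intro c hc hc0
      obtain ⟨f, hd, hf2, rfl⟩ := (mem_code m α v δ _).1 hc
      have hf0 : f ≠ 0 := by rintro rfl; simp at hc0
      have hn := norm_add_W m α v hv δ f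
      have := hW f hf0 hd hf2
      omega
end

section
/- Let k ≥ 3 and let α_1, …, α_{k−1} be elements of a field and δ an element of the same field. The determinant of the k×k matrix whose j-th column, for 1 ≤ j ≤ k−1, is (1, α_j, α_j^2, …, α_j^{k−2}, α_j^k)^T and whose last column is (0, 0, …, 0, 1, δ)^T equals (δ − (Σ_{i=1}^{k−1} α_i)^2 + Σ_{1≤i<j≤k−1} α_i α_j) · Π_{1≤i<j≤k−1}(α_j − α_i). -/
open Polynomial in
lemma coeffs_aux {R : Type*} [CommRing R] : ∀ (n : ℕ) (α : Fin n → R),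
    (∀ m, n < m → (∏ i, (X - C (α i))).coeff m = 0) ∧
    (∏ i, (X - C (α i))).coeff n = 1 ∧
    (∀ m, m + 1 = n → (∏ i, (X - C (α i))).coeff m = - ∑ i, α i) ∧
    (∀ m, m + 2 = n → (∏ i, (X - C (α i))).coeff m =
      ∑ i, ∑ j ∈ Finset.Ioi i, α i * α j) := by
  intro n
  induction n with
  | zero =>
    intro α
    refine ⟨?_, by simp, by intro m h; omega, by intro m h; omega⟩
    intro m hm
    simp [coeff_one]; omega
  | succ n ih =>
    intro α
    obtain ⟨h0, h1, h2, h3⟩ := ih (fun i => α i.succ)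
    have key : ∀ m, (∏ i, (X - C (α i))).coeff (m+1) =
        (∏ i : Fin n, (X - C (α i.succ))).coeff m
          - α 0 * (∏ i : Fin n, (X - C (α i.succ))).coeff (m+1) := by
      intro m
      rw [Fin.prod_univ_succ, sub_mul, coeff_sub, coeff_X_mul, coeff_C_mul]
    have key0 : (∏ i, (X - C (α i))).coeff 0 =
          - α 0 * (∏ i : Fin n, (X - C (α i.succ))).coeff 0 := by
      rw [Fin.prod_univ_succ, sub_mul, coeff_sub, coeff_C_mul]
      simp
    refine ⟨?_, ?_, ?_, ?_⟩
    · intro m hm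
      obtain ⟨m, rfl⟩ : ∃ l, m = l + 1 := ⟨m - 1, by omega⟩
      rw [key, h0 m (by omega), h0 (m+1) (by omega)]; simp
    · rw [key, h1, h0 (n+1) (by omega)]; simp
    · intro m hm
      obtain rfl : m = n := by omega
      rw [Fin.sum_univ_succ]
      cases m with
      | zero => rw [key0, h1]; simp
      | succ m => rw [key, h1, h2 m rfl]; ring
    · intro m hm
      rw [Fin.sum_univ_succ]
      simp only [Fin.sum_Ioi_zero, Fin.sum_Ioi_succ, ← Finset.mul_sum]
      simp only [← Finset.mul_sum] at h3
      cases m with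
      | zero =>
        obtain rfl : n = 1 := by omega
        rw [key0, h2 0 rfl]; simp
      | succ m => rw [key, h3 m (by omega), h2 (m+1) (by omega)]; ring

open Polynomial in
lemma poly_aux {R : Type*} [CommRing R] (n : ℕ) (α : Fin (n+2) → R) :
    ∃ c : Fin (n+2) → R,
      (∀ j, ∑ i, c i * α j ^ (i : ℕ) + α j ^ (n+3) = 0) ∧
      c (Fin.last _) = - (∑ i, α i) ^ 2 + ∑ i, ∑ j ∈ Finset.Ioi i, α i * α j := by
  obtain ⟨h0, h1, h2, h3⟩ := coeffs_aux (n+2) α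
  set h := ∏ i, (X - C (α i)) with hh
  set s := ∑ i, α i
  let q : R[X] := X * h + C s * h
  have hq : ∀ m, q.coeff (m+1) = h.coeff m + s * h.coeff (m+1) := by
    intro m; simp [q]
  refine ⟨fun i => q.coeff i, ?_, ?_⟩
  · intro j
    have hdeg : q.natDegree < n + 4 := by
      rw [Nat.lt_succ_iff, natDegree_le_iff_coeff_eq_zero]
      intro m hm
      obtain ⟨m, rfl⟩ : ∃ l, m = l + 1 := ⟨m - 1, by omega⟩
      rw [hq, h0 m (by omega), h0 (m+1) (by omega)]; simp
    have he : q.eval (α j) = 0 := by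
      have : h.eval (α j) = 0 := by
        rw [hh, eval_prod]
        exact Finset.prod_eq_zero (Finset.mem_univ j) (by simp)
      simp [q, this]
    rw [eval_eq_sum_range' hdeg, Finset.sum_range_succ, Finset.sum_range_succ,
      hq (n+2), hq (n+1), h1, h0 (n+3) (by omega), h2 (n+1) rfl,
      Finset.sum_range] at he
    rw [← he]; ring
  · simp only [Fin.val_last]
    rw [hq, h2 (n+1) rfl, h3 n rfl]; ring

/-- The k×k matrix whose `j`-th column, for `1 ≤ j ≤ k-1`, is
`(1, α_j, α_j², …, α_j^{k-2}, α_j^k)ᵀ` and whose last column is `(0, …, 0, 1, δ)ᵀ`: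
its determinant equals
`(δ - (∑ α_i)² + ∑_{i<j} α_i α_j) · ∏_{i<j} (α_j - α_i)`. -/
theorem stmt_15 (R : Type*) [CommRing R] (k : ℕ) (hk : 3 ≤ k)
    (α : Fin (k - 1) → R) (δ : R) :
    (Matrix.of fun i j : Fin k =>
        if hj : (j : ℕ) < k - 1 then
          α ⟨j, hj⟩ ^ (if (i : ℕ) = k - 1 then k else (i : ℕ))
        else if (i : ℕ) = k - 2 then 1 else if (i : ℕ) = k - 1 then δ else 0).det =
      (δ - (∑ i, α i) ^ 2 + ∑ i, ∑ j ∈ Finset.Ioi i, α i * α j) *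
        ∏ i, ∏ j ∈ Finset.Ioi i, (α j - α i) := by
  obtain ⟨n, rfl⟩ : ∃ n, k = n + 3 := ⟨k - 3, by omega⟩
  change Fin (n+2) → R at α
  obtain ⟨c, hc, hl⟩ := poly_aux n α
  change _ = (δ - (∑ i : Fin (n+2), α i) ^ 2 +
    ∑ i : Fin (n+2), ∑ j ∈ Finset.Ioi i, α i * α j) *
        ∏ i : Fin (n+2), ∏ j ∈ Finset.Ioi i, (α j - α i)
  rw [← Matrix.det_vandermonde, ← Matrix.det_transpose (Matrix.vandermonde α)]
  generalize hM : (Matrix.of fun i j : Fin (n+3) => _) = M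
  have e1 : ∀ i j : Fin (n+2), M i.castSucc j.castSucc = α j ^ (i : ℕ) := by
    intro i j
    have := i.2
    have := j.2
    subst hM
    simp [Matrix.of_apply, show (i:ℕ) ≠ n+2 by omega]
  have e2 : ∀ j : Fin (n+2), M (Fin.last _) j.castSucc = α j ^ (n+3) := by
    intro j
    have := j.2
    subst hM
    simp [Matrix.of_apply]
  have e3 : ∀ i : Fin (n+2), M i.castSucc (Fin.last _) = if i = Fin.last _ then 1 else 0 := by
    intro i
    have := i.2
    subst hM
    simp [Matrix.of_apply, Fin.ext_iff, show (i:ℕ) ≠ n+2 by omega]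
  have e4 : M (Fin.last _) (Fin.last _) = δ := by
    subst hM
    simp [Matrix.of_apply]
  have hd := Matrix.det_updateRow_sum M (Fin.last _) (Fin.snoc c 1 : Fin (n+3) → R)
  rw [Fin.snoc_last, one_smul] at hd
  rw [← hd, Matrix.det_succ_row _ (Fin.last _), Fin.sum_univ_castSucc, Finset.sum_eq_zero]
  · have hs : (M.updateRow (Fin.last (n+2))
        (∑ k, (Fin.snoc c 1 : Fin (n+3) → R) k • M k)).submatrix
        (Fin.last (n+2)).succAbove (Fin.last (n+2)).succAbove = (Matrix.vandermonde α).transpose := by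
      ext i j
      simp [Matrix.updateRow_apply, e1, Matrix.vandermonde_apply]
    rw [hs, Matrix.updateRow_self, Finset.sum_apply, Fin.sum_univ_castSucc]
    simp [e3, e4, hl, ← two_mul, pow_mul]
    ring
  · intro j _
    rw [Matrix.updateRow_self, Finset.sum_apply, Fin.sum_univ_castSucc]
    simp [e1, e2, hc]
end
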